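/- arXiv:math/0305243 — 2 statements merged into one kernel-verified Lean document; each statement's English description precedes it below -/
import Mathlib

section
/- Let G be a group with a weak action (μ, α, a) on a category C. Then there exist a category C', a strict action of G on C' (written (γ, P) ↦ γ·P), a functor u : C' ⥤ C which is an equivalence of categories, and isomorphisms σ_γ^P : μ_γ(u(P)) ≅ u(γ·P), natural in P, such that for all γ, δ ∈ G and every object P of C' one has σ_{γδ}^P ∘ α_{γ,δ}^{u(P)} = σ_γ^{δ·P} ∘ μ_γ(σ_δ^P). In other words, every weak action of a group on a category is equivalent, via an equivariant equivalence, to a strict action. -/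
open CategoryTheory

universe v u w

/-- A weak action of a group `G` on a category `C`: functors `μ g`, together with
coherent natural isomorphisms `α g h : μ g ∘ μ h ≅ μ (g * h)` and `a : μ 1 ≅ 𝟭 C`. -/
structure WeakAction (G : Type w) [Group G] (C : Type u) [Category.{v} C] where
  /-- the functor by which `g` acts -/
  μ : G → C ⥤ C
  /-- `α g h` has components `α_{g,h}^x : μ g (μ h x) ≅ μ (g*h) x`, natural in `x` -/
  α : ∀ g h : G, μ h ⋙ μ g ≅ μ (g * h)
  /-- `a` has components `a^x : μ 1 x ≅ x`, natural in `x` -/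
  a : μ (1 : G) ≅ 𝟭 C
  /-- associativity coherence:
  `α_{g,hk}^x ∘ μ_g(α_{h,k}^x) = α_{gh,k}^x ∘ α_{g,h}^{μ_k(x)}` -/
  assoc : ∀ (g h k : G) (x : C),
    (μ g).map ((α h k).hom.app x) ≫ (α g (h * k)).hom.app x =
      (α g h).hom.app ((μ k).obj x) ≫ (α (g * h) k).hom.app x ≫
        eqToHom (by rw [mul_assoc])
  /-- unit coherence: `μ_1(a^x) = α_{1,1}^x` -/
  unit : ∀ x : C,
    (μ (1 : G)).map (a.hom.app x) =
      (α (1 : G) (1 : G)).hom.app x ≫ eqToHom (by rw [one_mul, Functor.id_obj])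

/-- A strict action of a group `G` on a category `C'`: a monoid homomorphism from `G`
to the monoid of endofunctors of `C'` under composition, i.e. `μ 1 = 𝟭 C'` and
`μ g ∘ μ h = μ (g * h)` on the nose.  We write `γ·P` for `(μ γ).obj P`. -/
structure StrictAction (G : Type w) [Group G] (C' : Type u) [Category.{v} C'] where
  /-- the endofunctor by which `g` acts -/
  μ : G → C' ⥤ C'
  /-- `1` acts as the identity functor -/
  one : μ (1 : G) = 𝟭 C'
  /-- `μ g ∘ μ h = μ (g*h)` on the nose -/
  mul : ∀ g h : G, μ (g * h) = μ h ⋙ μ g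

namespace WeakAction

variable {G : Type w} [Group G] {C : Type u} [Category.{v} C] (A : WeakAction G C)

theorem faithful_μ_one : (A.μ (1 : G)).Faithful :=
  Functor.Faithful.of_iso A.a.symm

theorem α_comp_eqToHom_left {g g' : G} (e : g = g') (h : G) (x : C) :
    (A.α g h).hom.app x ≫ eqToHom (by rw [e]) =
      eqToHom (by rw [e]) ≫ (A.α g' h).hom.app x := by
  subst e; simp

theorem α_comp_eqToHom_right (g : G) {h h' : G} (e : h = h') (x : C) :
    (A.α g h).hom.app x ≫ eqToHom (by rw [e]) =
      (A.μ g).map (eqToHom (by rw [e])) ≫ (A.α g h').hom.app x := by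
  subst e; simp

/-- The left unit coherence at every group element follows from the one at `1`, because `μ 1` is
faithful. -/
theorem α_one_left (g : G) (x : C) :
    (A.α 1 g).hom.app x ≫ eqToHom (by rw [one_mul]; rfl) = A.a.hom.app ((A.μ g).obj x) := by
  have := A.faithful_μ_one
  apply (A.μ 1).map_injective
  have h₁ := A.α_comp_eqToHom_right 1 (one_mul g) x
  have h₂ := A.α_comp_eqToHom_left (one_mul 1) g x
  have h₃ := A.assoc 1 1 g x
  rw [A.unit, Functor.map_comp, ← cancel_mono ((A.α 1 g).hom.app x), Category.assoc,
    Category.assoc]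
  erw [← h₁, ← h₂]
  rw [← Category.assoc, h₃, Category.assoc, Category.assoc, eqToHom_trans]

/-- A functor `T` for which a faithful functor `F` is equivariant along `a` is the identity,
as soon as it is the identity on objects. -/
theorem eq_id_of_equivariant {D : Type*} [Category.{v} D] {F : D ⥤ C} [F.Faithful]
    {T : D ⥤ D} (σ : F ⋙ A.μ 1 ≅ T ⋙ F) (hT : ∀ P, T.obj P = P)
    (hσ : ∀ P, σ.hom.app P ≫ eqToHom (congrArg F.obj (hT P)) = A.a.hom.app (F.obj P)) :
    T = 𝟭 D := by
  refine CategoryTheory.Functor.ext hT fun P Q f => F.map_injective ?_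
  have hn := A.a.hom.naturality (F.map f)
  have hs := σ.hom.naturality f
  rw [← hσ, ← hσ] at hn
  dsimp only [Functor.comp_map, Functor.comp_obj, Functor.id_map, Functor.id_obj] at hn hs ⊢
  rw [reassoc_of% hs, Category.assoc, cancel_epi, comp_eqToHom_iff] at hn
  simpa [eqToHom_map] using hn

/-- Functors for which a faithful functor `F` is coherently equivariant compose strictly,
as soon as they do so on objects. -/
theorem eq_comp_of_equivariant {D : Type*} [Category.{v} D] {F : D ⥤ C} [F.Faithful]
    {T : G → D ⥤ D} (σ : ∀ g : G, F ⋙ A.μ g ≅ T g ⋙ F) (g h : G)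
    (hT : ∀ P, (T (g * h)).obj P = (T g).obj ((T h).obj P))
    (hσ : ∀ P, (A.α g h).hom.app (F.obj P) ≫ (σ (g * h)).hom.app P =
      (A.μ g).map ((σ h).hom.app P) ≫ (σ g).hom.app ((T h).obj P) ≫
        eqToHom (congrArg F.obj (hT P).symm)) :
    T (g * h) = T h ⋙ T g := by
  refine CategoryTheory.Functor.ext hT fun P Q f => F.map_injective ?_
  have hn := (A.α g h).hom.naturality (F.map f)
  have hgh := (σ (g * h)).hom.naturality f
  have hh := congrArg (A.μ g).map ((σ h).hom.naturality f)
  have hg := (σ g).hom.naturality ((T h).map f)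
  have hP := hσ P
  have hQ := hσ Q
  dsimp only [Functor.comp_map, Functor.comp_obj] at hn hgh hh hg hP hQ ⊢
  simp only [Functor.map_comp] at hh
  rw [← cancel_epi ((σ (g * h)).hom.app P)]
  rw [← cancel_epi ((A.α g h).hom.app (F.obj P))]
  dsimp only [Functor.comp_obj]
  rw [← hgh, ← reassoc_of% hn, hQ, reassoc_of% hh, reassoc_of% hg, reassoc_of% hP]
  simp [eqToHom_map]

/-- The strictification of `A`: its objects are the formal translates `g·x`, represented by pairs
`(g, x)`, and its morphisms `(g, x) ⟶ (h, y)` are the morphisms `μ g x ⟶ μ h y` of `C`. -/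
abbrev Strictification : Type max w u :=
  InducedCategory C fun P : G × C => (A.μ P.1).obj P.2

/-- The evaluation functor from the strictification, sending `(g, x)` to `μ g x`. -/
abbrev eval : A.Strictification ⥤ C := inducedFunctor _

/-- Translation of formal translates by `γ`. -/
def translate (γ : G) : A.Strictification ⥤ A.Strictification where
  obj P := (γ * P.1, P.2)
  map {P Q} f := InducedCategory.homMk
    ((A.α γ P.1).inv.app P.2 ≫ (A.μ γ).map f.hom ≫ (A.α γ Q.1).hom.app Q.2)
  map_id P := InducedCategory.hom_ext (by
    erw [(A.μ γ).map_id, Category.id_comp, Iso.inv_hom_id_app]; rfl)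
  map_comp {P Q R} f f' := InducedCategory.hom_ext (by
    change _ ≫ (A.μ γ).map (f.hom ≫ f'.hom) ≫ _ = (_ ≫ _ ≫ _) ≫ (_ ≫ _ ≫ _)
    simp)

theorem translate_one_obj (P : A.Strictification) : (A.translate 1).obj P = P :=
  congrArg (fun g => (g, P.2)) (one_mul P.1)

theorem translate_mul_obj (g h : G) (P : A.Strictification) :
    (A.translate (g * h)).obj P = (A.translate g).obj ((A.translate h).obj P) :=
  congrArg (fun k => (k, P.2)) (mul_assoc g h P.1)

/-- The evaluation functor is equivariant up to natural isomorphism. -/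
def evalTranslateIso (γ : G) : A.eval ⋙ A.μ γ ≅ A.translate γ ⋙ A.eval :=
  NatIso.ofComponents (fun P => (A.α γ P.1).app P.2) fun {P _} _ =>
    ((A.α γ P.1).hom_inv_id_app_assoc P.2 _).symm

theorem evalTranslateIso_mul (γ δ : G) (P : A.Strictification) :
    (A.α γ δ).hom.app (A.eval.obj P) ≫ (A.evalTranslateIso (γ * δ)).hom.app P =
      (A.μ γ).map ((A.evalTranslateIso δ).hom.app P) ≫
        (A.evalTranslateIso γ).hom.app ((A.translate δ).obj P) ≫
          eqToHom (congrArg A.eval.obj (A.translate_mul_obj γ δ P).symm) := by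
  have h := A.assoc γ δ P.1 P.2
  rw [← Category.assoc, ← comp_eqToHom_iff, Category.assoc] at h
  exact h.symm

/-- The strict action of `G` on the strictification, by translation of formal translates. -/
def strictAction : StrictAction G A.Strictification where
  μ := A.translate
  one := A.eq_id_of_equivariant (A.evalTranslateIso 1) A.translate_one_obj
    fun P => A.α_one_left P.1 P.2
  mul g h := A.eq_comp_of_equivariant A.evalTranslateIso g h
    (A.translate_mul_obj g h) (A.evalTranslateIso_mul g h)

instance isEquivalence_eval : A.eval.IsEquivalence where
  essSurj := ⟨fun x => ⟨((1 : G), x), ⟨A.a.app x⟩⟩⟩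

end WeakAction

/-- Every weak action `(μ, α, a)` of a group `G` on a category `C` is
equivalent to a strict action: there are a category `C'`, a strict action `ρ` of `G` on
`C'`, a functor `u : C' ⥤ C` which is an equivalence of categories, and natural
isomorphisms `σ γ` with components `σ_γ^P : μ_γ(u(P)) ≅ u(γ·P)` such that
`σ_{γδ}^P ∘ α_{γ,δ}^{u(P)} = σ_γ^{δ·P} ∘ μ_γ(σ_δ^P)` for all `γ δ : G` and `P : C'`. -/
theorem weakAction_strictification {G : Type w} [Group G] {C : Type u} [Category.{v} C]
    (A : WeakAction G C) :
    ∃ (C' : Type max w u) (_ : Category.{v} C') (ρ : StrictAction G C')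
      (u : C' ⥤ C) (_ : u.IsEquivalence)
      (σ : ∀ γ : G, u ⋙ A.μ γ ≅ ρ.μ γ ⋙ u),
      ∀ (γ δ : G) (P : C'),
        (A.α γ δ).hom.app (u.obj P) ≫ (σ (γ * δ)).hom.app P =
          (A.μ γ).map ((σ δ).hom.app P) ≫ (σ γ).hom.app ((ρ.μ δ).obj P) ≫
            eqToHom (by rw [ρ.mul]; rfl) := by
  exact ⟨A.Strictification, inferInstance, A.strictAction, A.eval, A.isEquivalence_eval,
    A.evalTranslateIso, A.evalTranslateIso_mul⟩
end

section
/- Let G be a group with a weak action (μ, α, a) on a category C. Then the strictified data C^str — objects the pairs (g, x) with g ∈ G and x an object of C; morphisms (g,x) → (h,y) the morphisms φ : x → μ_{g⁻¹h}(y) of C; composition of φ : (g,x) → (h,y) and ψ : (h,y) → (k,z) equal to α_{g⁻¹h, h⁻¹k}^z ∘ μ_{g⁻¹h}(ψ) ∘ φ; identity of (g,x) equal to the inverse of a^x : μ_1(x) ≅ x regarded as a morphism x → μ_{g⁻¹g}(x) — satisfies the unit and associativity laws, i.e. C^str is a category. -/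
open CategoryTheory

universe v u w

variable {G : Type w} [Group G] {C : Type u} [Category.{v} C]

/-- The strictified category `C^str` attached to a weak action: its objects are pairs
`(g, x)` with `g ∈ G` and `x` an object of `C`. -/
@[nolint unusedArguments]
def Str (_A : WeakAction G C) : Type max w u := G × C

/-- Morphisms `(g,x) ⟶ (h,y)` in `C^str` are morphisms `x ⟶ μ (g⁻¹ * h) y` of `C`;
the identity of `(g,x)` is the inverse of `a^x` regarded as a morphism
`x ⟶ μ (g⁻¹ * g) x`; the composite of `φ : (g,x) ⟶ (h,y)` and `ψ : (h,y) ⟶ (k,z)` is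
`α_{g⁻¹h, h⁻¹k}^z ∘ μ_{g⁻¹h}(ψ) ∘ φ`. -/
instance Str.categoryStruct (A : WeakAction G C) : CategoryStruct (Str A) where
  Hom P Q := P.2 ⟶ (A.μ (P.1⁻¹ * Q.1)).obj Q.2
  id P := A.a.inv.app P.2 ≫ eqToHom (by rw [inv_mul_cancel])
  comp {P Q R} φ ψ :=
    φ ≫ (A.μ (P.1⁻¹ * Q.1)).map ψ ≫
      (A.α (P.1⁻¹ * Q.1) (Q.1⁻¹ * R.1)).hom.app R.2 ≫
        eqToHom (by rw [show (P.1⁻¹ * Q.1) * (Q.1⁻¹ * R.1) = P.1⁻¹ * R.1 by group])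

namespace WeakAction

/-- The component `μ g (μ h x) ⟶ μ k x` of the multiplication constraint, for any `k = g * h`. -/
def mulHom (A : WeakAction G C) {g h k : G} (e : g * h = k) (x : C) :
    (A.μ g).obj ((A.μ h).obj x) ⟶ (A.μ k).obj x :=
  (A.α g h).hom.app x ≫ eqToHom (by rw [e])

/-- The component `x ⟶ μ g x` of the inverse unit constraint, for any `g = 1`. -/
def unitHom (A : WeakAction G C) {g : G} (e : 1 = g) (x : C) : x ⟶ (A.μ g).obj x :=
  A.a.inv.app x ≫ eqToHom (by rw [e])

instance (A : WeakAction G C) {g h k : G} (e : g * h = k) (x : C) : IsIso (A.mulHom e x) := by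
  unfold mulHom; infer_instance

theorem mulHom_naturality (A : WeakAction G C) {g h k : G} (e : g * h = k) {x y : C}
    (f : x ⟶ y) :
    (A.μ g).map ((A.μ h).map f) ≫ A.mulHom e y = A.mulHom e x ≫ (A.μ k).map f := by
  subst e
  simpa [mulHom] using (A.α g h).hom.naturality f

theorem mulHom_naturality_assoc (A : WeakAction G C) {g h k : G} (e : g * h = k) {x y z : C}
    (f : x ⟶ y) (t : (A.μ k).obj y ⟶ z) :
    (A.μ g).map ((A.μ h).map f) ≫ A.mulHom e y ≫ t = A.mulHom e x ≫ (A.μ k).map f ≫ t := by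
  rw [← Category.assoc, mulHom_naturality, Category.assoc]

theorem mulHom_assoc (A : WeakAction G C) {g h k gh hk ghk : G} (e₁ : g * h = gh)
    (e₂ : h * k = hk) (e₃ : g * hk = ghk) (e₄ : gh * k = ghk) (x : C) :
    (A.μ g).map (A.mulHom e₂ x) ≫ A.mulHom e₃ x =
      A.mulHom e₁ ((A.μ k).obj x) ≫ A.mulHom e₄ x := by
  subst e₁ e₂ e₃
  simpa [mulHom] using A.assoc g h k x

theorem map_a_hom_app (A : WeakAction G C) (x : C) :
    (A.μ 1).map (A.a.hom.app x) = A.mulHom (mul_one 1) x :=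
  A.unit x

/-- The right unit law of a weak action. -/
theorem map_a_hom_app_eq_mulHom (A : WeakAction G C) (g : G) (x : C) :
    (A.μ g).map (A.a.hom.app x) = A.mulHom (mul_one g) x := by
  have h₁ := A.mulHom_assoc (mul_one g) (mul_one 1) (mul_one g) (mul_one g) x
  rw [cancel_mono, ← map_a_hom_app] at h₁
  have h₂ := A.mulHom_naturality (mul_one g) (A.a.hom.app x)
  rw [h₁] at h₂
  exact ((cancel_epi _).1 h₂).symm

/-- The left unit law of a weak action. -/
theorem a_hom_app_eq_mulHom (A : WeakAction G C) (g : G) (x : C) :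
    A.a.hom.app ((A.μ g).obj x) = A.mulHom (one_mul g) x := by
  have h₁ := A.mulHom_assoc (one_mul 1) (one_mul g) (one_mul g) (one_mul g) x
  rw [cancel_mono, ← map_a_hom_app] at h₁
  have : (A.μ 1).Faithful := Functor.Faithful.of_iso A.a.symm
  exact ((A.μ 1).map_injective h₁).symm

theorem map_unitHom_mulHom (A : WeakAction G C) {g h : G} (e : 1 = h) (e' : g * h = g) (x : C) :
    (A.μ g).map (A.unitHom e x) ≫ A.mulHom e' x = 𝟙 _ := by
  subst e
  rw [← map_a_hom_app_eq_mulHom, ← Functor.map_comp]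
  simp [unitHom]

theorem unitHom_map_mulHom (A : WeakAction G C) {g h : G} (e : 1 = g) (e' : g * h = h) {x y : C}
    (f : x ⟶ (A.μ h).obj y) :
    A.unitHom e x ≫ (A.μ g).map f ≫ A.mulHom e' y = f := by
  subst e
  rw [← a_hom_app_eq_mulHom, A.a.hom.naturality]
  simp [unitHom]

end WeakAction

theorem Str.id_eq {A : WeakAction G C} (P : Str A) :
    𝟙 P = A.unitHom (inv_mul_cancel P.1).symm P.2 :=
  rfl

theorem Str.comp_eq {A : WeakAction G C} {P Q R : Str A} (f : P ⟶ Q) (g : Q ⟶ R) :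
    f ≫ g = CategoryStruct.comp (obj := C) f ((A.μ (P.1⁻¹ * Q.1)).map g ≫
      A.mulHom (show (P.1⁻¹ * Q.1) * (Q.1⁻¹ * R.1) = P.1⁻¹ * R.1 by group) R.2) :=
  rfl

/-- The strictified data `C^str` attached to a weak action of a group `G`
on a category `C` satisfies the unit and associativity laws, i.e. `C^str` is a category. -/
theorem str_is_category (A : WeakAction G C) :
    (∀ (P Q : Str A) (f : P ⟶ Q), 𝟙 P ≫ f = f) ∧
    (∀ (P Q : Str A) (f : P ⟶ Q), f ≫ 𝟙 Q = f) ∧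
    (∀ (P Q R S : Str A) (f : P ⟶ Q) (g : Q ⟶ R) (h : R ⟶ S),
      (f ≫ g) ≫ h = f ≫ g ≫ h) := by
  refine ⟨fun P Q f => ?_, fun P Q f => ?_, fun P Q R S f g h => ?_⟩
  · exact A.unitHom_map_mulHom (inv_mul_cancel P.1).symm (by group) f
  · rw [Str.comp_eq, Str.id_eq, A.map_unitHom_mulHom]
    exact Category.comp_id (obj := C) f
  · simp only [Str.comp_eq, Functor.map_comp, Category.assoc]
    rw [A.mulHom_assoc (gh := P.1⁻¹ * R.1) (by group) _ _ (by group),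
      A.mulHom_naturality_assoc]
end
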